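/- Let Q : [0,b] → M₂(ℂ) be continuous and F : [-b,b] → M₂(ℂ) continuous. The integral equation H(ξ,η) = P⁺[F](2ξ-b) + P⁻[F](b-2η) - ∫_ξ^{b-η} B Q(u+η) P⁺[H(u,η)] du - ∫_η^{b-ξ} B Q(ξ+v) P⁻[H(ξ,v)] dv has a unique continuous solution H on the triangle Ξ⁺ = {(ξ,η) : 0 ≤ ξ ≤ b, 0 ≤ η ≤ b-ξ}, and |H(ξ,η)| ≤ 2·sup|F|·exp(b·sup|Q|) for all (ξ,η) ∈ Ξ⁺. -/

import Mathlib

open Matrix Set intervalIntegral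

noncomputable section

attribute [local instance] Matrix.frobeniusNormedAddCommGroup Matrix.frobeniusNormedSpace

/-- The matrix B = [[0,1],[-1,0]]. -/
def Bmat : Matrix (Fin 2) (Fin 2) ℂ := !![0, 1; -1, 0]

/-- P⁻[A] = (A - BAB)/2. -/
def Pminus (A : Matrix (Fin 2) (Fin 2) ℂ) : Matrix (Fin 2) (Fin 2) ℂ :=
  (2⁻¹ : ℂ) • (A - Bmat * A * Bmat)

/-- P⁺[A] = (A + BAB)/2. -/
def Pplus (A : Matrix (Fin 2) (Fin 2) ℂ) : Matrix (Fin 2) (Fin 2) ℂ :=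
  (2⁻¹ : ℂ) • (A + Bmat * A * Bmat)

/-- The triangle Ξ⁺ = {(ξ,η) : 0 ≤ ξ ≤ b, 0 ≤ η ≤ b - ξ}. -/
def Xi (b : ℝ) : Set (ℝ × ℝ) := {p | 0 ≤ p.1 ∧ 0 ≤ p.2 ∧ p.1 + p.2 ≤ b}


/-- Conjugation by the unitary diagonalising `Bmat`. -/
def Phi (A : Matrix (Fin 2) (Fin 2) ℂ) : Matrix (Fin 2) (Fin 2) ℂ :=
  !![2⁻¹ * (A 0 0 + Complex.I * A 0 1 - Complex.I * A 1 0 + A 1 1),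
     2⁻¹ * (A 0 0 - Complex.I * A 0 1 - Complex.I * A 1 0 - A 1 1);
     2⁻¹ * (A 0 0 + Complex.I * A 0 1 + Complex.I * A 1 0 - A 1 1),
     2⁻¹ * (A 0 0 - Complex.I * A 0 1 + Complex.I * A 1 0 + A 1 1)]

theorem frob_sq {𝕜 : Type*} [RCLike 𝕜] (A : Matrix (Fin 2) (Fin 2) 𝕜) :
    ‖A‖ ^ 2 = ‖A 0 0‖ ^ 2 + ‖A 0 1‖ ^ 2 + (‖A 1 0‖ ^ 2 + ‖A 1 1‖ ^ 2) := by
  rw [Matrix.frobenius_norm_def, ← Real.sqrt_eq_rpow, Real.sq_sqrt (by positivity)]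
  simp [Fin.sum_univ_two]

theorem frob_le {𝕜 𝕜' : Type*} [RCLike 𝕜] [RCLike 𝕜'] (A : Matrix (Fin 2) (Fin 2) 𝕜)
    (A' : Matrix (Fin 2) (Fin 2) 𝕜') (h : ∀ i j, ‖A i j‖ ≤ ‖A' i j‖) : ‖A‖ ≤ ‖A'‖ := by
  apply le_of_sq_le_sq _ (norm_nonneg _)
  rw [frob_sq, frob_sq]
  gcongr <;> apply h

theorem entry_le {𝕜 : Type*} [RCLike 𝕜] (A : Matrix (Fin 2) (Fin 2) 𝕜) (i j : Fin 2) :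
    ‖A i j‖ ≤ ‖A‖ := by
  apply le_of_sq_le_sq _ (norm_nonneg _)
  rw [frob_sq]
  fin_cases i <;> fin_cases j <;> simp <;> nlinarith [sq_nonneg ‖A 0 0‖, sq_nonneg ‖A 0 1‖, sq_nonneg ‖A 1 0‖, sq_nonneg ‖A 1 1‖]

theorem norm_Phi (A : Matrix (Fin 2) (Fin 2) ℂ) : ‖Phi A‖ = ‖A‖ := by
  rw [← sq_eq_sq₀ (norm_nonneg _) (norm_nonneg _), frob_sq, frob_sq]
  simp only [Complex.sq_norm, Complex.normSq_apply]
  simp [Phi]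
  ring

theorem Bm0 (A : Matrix (Fin 2) (Fin 2) ℂ) (j : Fin 2) : (Bmat * A) 0 j = A 1 j := by
  rw [Matrix.mul_apply, Fin.sum_univ_two]; simp [Bmat]

theorem Bm1 (A : Matrix (Fin 2) (Fin 2) ℂ) (j : Fin 2) : (Bmat * A) 1 j = -A 0 j := by
  rw [Matrix.mul_apply, Fin.sum_univ_two]; simp [Bmat]

theorem mB0 (A : Matrix (Fin 2) (Fin 2) ℂ) (j : Fin 2) : (A * Bmat) j 0 = -A j 1 := by
  rw [Matrix.mul_apply, Fin.sum_univ_two]; simp [Bmat]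

theorem mB1 (A : Matrix (Fin 2) (Fin 2) ℂ) (j : Fin 2) : (A * Bmat) j 1 = A j 0 := by
  rw [Matrix.mul_apply, Fin.sum_univ_two]; simp [Bmat]

theorem mul_two_apply (A A' : Matrix (Fin 2) (Fin 2) ℂ) (i j : Fin 2) :
    (A * A') i j = A i 0 * A' 0 j + A i 1 * A' 1 j := by
  rw [Matrix.mul_apply, Fin.sum_univ_two]

theorem Phi_plus (Q A : Matrix (Fin 2) (Fin 2) ℂ) (i j : Fin 2) :
    ‖Phi (Bmat * Q * Pplus A) i j‖ = ‖Phi Q i (j + 1)‖ * ‖Phi A (j + 1) j‖ := by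
  suffices h : Phi (Bmat * Q * Pplus A) i j =
      (if i = 0 then Complex.I else -Complex.I) * (Phi Q i (j + 1) * Phi A (j + 1) j) by
    rw [h, norm_mul, norm_mul]
    split_ifs <;> simp
  fin_cases i <;> fin_cases j <;>
  · rw [show ∀ X, Bmat * Q * X = Bmat * (Q * X) from fun X => Matrix.mul_assoc _ _ _]
    simp [Phi, Pplus, Bm0, Bm1, mB0, mB1, mul_two_apply Q]
    ring_nf
    simp [show Complex.I ^ 3 = -Complex.I by rw [pow_succ, Complex.I_sq]; ring]
    try ring

theorem Phi_minus (Q A : Matrix (Fin 2) (Fin 2) ℂ) (i j : Fin 2) :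
    ‖Phi (Bmat * Q * Pminus A) i j‖ = ‖Phi Q i j‖ * ‖Phi A j j‖ := by
  suffices h : Phi (Bmat * Q * Pminus A) i j =
      (if i = 0 then Complex.I else -Complex.I) * (Phi Q i j * Phi A j j) by
    rw [h, norm_mul, norm_mul]
    split_ifs <;> simp
  fin_cases i <;> fin_cases j <;>
  · rw [show ∀ X, Bmat * Q * X = Bmat * (Q * X) from fun X => Matrix.mul_assoc _ _ _]
    simp [Phi, Pminus, Bm0, Bm1, mB0, mB1, mul_two_apply Q]
    ring_nf
    simp [show Complex.I ^ 3 = -Complex.I by rw [pow_succ, Complex.I_sq]; ring]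
    try ring

/-- Entries of `Phi` as continuous linear maps. -/
def phiL (i j : Fin 2) : Matrix (Fin 2) (Fin 2) ℂ →L[ℝ] ℂ :=
  LinearMap.toContinuousLinearMap
    { toFun := fun A => Phi A i j
      map_add' := by
        intro A A'
        fin_cases i <;> fin_cases j <;> simp [Phi] <;> ring
      map_smul' := by
        intro r A
        fin_cases i <;> fin_cases j <;> simp [Phi] <;> ring }

theorem phiL_apply (i j : Fin 2) (A : Matrix (Fin 2) (Fin 2) ℂ) : phiL i j A = Phi A i j := rfl

theorem phi_data (F F' : Matrix (Fin 2) (Fin 2) ℂ) (c : ℝ) (h : ‖F‖ ≤ c) (h' : ‖F'‖ ≤ c)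
    (i j : Fin 2) : ‖Phi (Pplus F + Pminus F') i j‖ ≤ c := by
  have : Phi (Pplus F + Pminus F') i j = if i = j then Phi F' i j else Phi F i j := by
    fin_cases i <;> fin_cases j <;>
    · simp [Phi, Pplus, Pminus, Bm0, Bm1, mB0, mB1]
      ring
  rw [this]
  split_ifs
  · exact (entry_le _ _ _).trans ((norm_Phi _).le.trans h')
  · exact (entry_le _ _ _).trans ((norm_Phi _).le.trans h)

theorem P_bounds : ∃ C : ℝ, 0 ≤ C ∧ ∀ Q A A' : Matrix (Fin 2) (Fin 2) ℂ,
    ‖Bmat * Q * Pplus A - Bmat * Q * Pplus A'‖ ≤ C * ‖Q‖ * ‖A - A'‖ ∧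
    ‖Bmat * Q * Pminus A - Bmat * Q * Pminus A'‖ ≤ C * ‖Q‖ * ‖A - A'‖ := by
  have key : ∀ D : Matrix (Fin 2) (Fin 2) ℂ, ‖Bmat * D * Bmat‖ ≤ ‖Bmat‖ * ‖D‖ * ‖Bmat‖ := by
    intro D
    exact (Matrix.frobenius_norm_mul _ _).trans (by gcongr; exact Matrix.frobenius_norm_mul _ _)
  refine ⟨‖Bmat‖ * (2⁻¹ * (1 + ‖Bmat‖ * ‖Bmat‖)), by positivity, fun Q A A' => ?_⟩
  have hp : ‖Pplus (A - A')‖ ≤ (2⁻¹ * (1 + ‖Bmat‖ * ‖Bmat‖)) * ‖A - A'‖ := by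
    unfold Pplus
    rw [norm_smul]
    have := (norm_add_le (A - A') (Bmat * (A - A') * Bmat)).trans (add_le_add_right (key _) _)
    have h2 : ‖(2⁻¹ : ℂ)‖ = 2⁻¹ := by simp
    rw [h2]
    linarith
  have hm : ‖Pminus (A - A')‖ ≤ (2⁻¹ * (1 + ‖Bmat‖ * ‖Bmat‖)) * ‖A - A'‖ := by
    unfold Pminus
    rw [norm_smul]
    have := (norm_sub_le (A - A') (Bmat * (A - A') * Bmat)).trans (add_le_add_right (key _) _)
    have h2 : ‖(2⁻¹ : ℂ)‖ = 2⁻¹ := by simp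
    rw [h2]
    linarith
  have e1 : Bmat * Q * Pplus A - Bmat * Q * Pplus A' = Bmat * Q * Pplus (A - A') := by
    rw [← mul_sub]; congr 1; unfold Pplus; rw [← smul_sub]; congr 1; noncomm_ring
  have e2 : Bmat * Q * Pminus A - Bmat * Q * Pminus A' = Bmat * Q * Pminus (A - A') := by
    rw [← mul_sub]; congr 1; unfold Pminus; rw [← smul_sub]; congr 1; noncomm_ring
  have hBQ := Matrix.frobenius_norm_mul Bmat Q
  rw [e1, e2]
  constructor
  · calc _ ≤ ‖Bmat * Q‖ * ‖Pplus (A - A')‖ := Matrix.frobenius_norm_mul _ _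
      _ ≤ (‖Bmat‖ * ‖Q‖) * ((2⁻¹ * (1 + ‖Bmat‖ * ‖Bmat‖)) * ‖A - A'‖) := by gcongr
      _ = _ := by ring
  · calc _ ≤ ‖Bmat * Q‖ * ‖Pminus (A - A')‖ := Matrix.frobenius_norm_mul _ _
      _ ≤ (‖Bmat‖ * ‖Q‖) * ((2⁻¹ * (1 + ‖Bmat‖ * ‖Bmat‖)) * ‖A - A'‖) := by gcongr
      _ = _ := by ring

/-- Retraction of the plane onto the triangle. -/
def retr (b : ℝ) (p : ℝ × ℝ) : ℝ × ℝ :=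
  (min (max p.1 0) b, min (max p.2 0) (b - min (max p.1 0) b))

theorem retr_mem {b : ℝ} (hb : 0 ≤ b) (p : ℝ × ℝ) : retr b p ∈ Xi b := by
  have h1 : min (max p.1 0) b ≤ b := min_le_right _ _
  have h2 : 0 ≤ min (max p.1 0) b := le_min (le_max_right _ _) hb
  refine ⟨h2, le_min (le_max_right _ _) (by linarith), ?_⟩
  have := min_le_right (max p.2 0) (b - min (max p.1 0) b)
  simp only [retr]
  linarith

theorem retr_eq {b : ℝ} {p : ℝ × ℝ} (h : p ∈ Xi b) : retr b p = p := by
  obtain ⟨h1, h2, h3⟩ := h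
  have e : min (max p.1 0) b = p.1 := by
    rw [max_eq_left h1, min_eq_left (by linarith)]
  ext
  · exact e
  · simp only [retr, e]
    rw [max_eq_left h2, min_eq_left (by linarith)]

theorem retr_cont (b : ℝ) : Continuous (retr b) := by
  unfold retr
  fun_prop

theorem Xi_compact (b : ℝ) : IsCompact (Xi b) := by
  refine IsCompact.of_isClosed_subset (isCompact_Icc (a := ((0:ℝ), (0:ℝ))) (b := (b, b))) ?_ ?_
  · exact (isClosed_le continuous_const continuous_fst).inter
      ((isClosed_le continuous_const continuous_snd).inter
        (isClosed_le (continuous_fst.add continuous_snd) continuous_const))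
  · rintro ⟨x, y⟩ ⟨h1, h2, h3⟩
    simp only at h1 h2 h3
    exact ⟨⟨h1, h2⟩, ⟨by simp; linarith, by simp; linarith⟩⟩

section Exist
variable {E : Type*} [NormedAddCommGroup E] [NormedSpace ℝ E]

theorem cont_par (g : ℝ × ℝ → ℝ → E) (hg : Continuous (Function.uncurry g))
    (s t : ℝ × ℝ → ℝ) (hs : Continuous s) (ht : Continuous t) :
    Continuous (fun p => ∫ u in (s p)..(t p), g p u) := by
  have : (fun p => ∫ u in (s p)..(t p), g p u) =
      fun p => (∫ u in (0:ℝ)..(t p), g p u) - ∫ u in (0:ℝ)..(s p), g p u := by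
    ext p
    have hc : Continuous (g p) := hg.comp (by fun_prop : Continuous fun u => (p, u))
    rw [integral_interval_sub_left] <;> exact hc.intervalIntegrable _ _
  rw [this]
  exact (continuous_parametric_intervalIntegral_of_continuous hg ht).sub
    (continuous_parametric_intervalIntegral_of_continuous hg hs)

theorem exp_int (l s t : ℝ) (hl : 0 < l) :
    ∫ u in s..t, Real.exp (-l * (u - s)) ≤ l⁻¹ := by
  have h : ∀ u ∈ uIcc s t, HasDerivAt (fun u => -l⁻¹ * Real.exp (-l * (u - s)))
      (Real.exp (-l * (u - s))) u := by
    intro u _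
    have := ((((hasDerivAt_id u).sub_const s).const_mul (-l)).exp).const_mul (-l⁻¹)
    have e : -l⁻¹ * (Real.exp (-l * (u - s)) * (-l * 1)) = Real.exp (-l * (u - s)) := by
      field_simp
    exact e ▸ this
  rw [integral_eq_sub_of_hasDerivAt h (by apply Continuous.intervalIntegrable; fun_prop)]
  simp
  positivity

theorem diff_int (g g' : ℝ → E) (hg : Continuous g) (hg' : Continuous g') (s t l C : ℝ)
    (hst : s ≤ t) (hl : 0 < l) (hC : 0 ≤ C)
    (h : ∀ u ∈ Icc s t, ‖g u - g' u‖ ≤ Real.exp (-l * (u - s)) * C) :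
    ‖(∫ u in s..t, g u) - ∫ u in s..t, g' u‖ ≤ l⁻¹ * C := by
  rw [← integral_sub (hg.intervalIntegrable _ _) (hg'.intervalIntegrable _ _)]
  calc _ ≤ ∫ u in s..t, Real.exp (-l * (u - s)) * C := by
        apply norm_integral_le_of_norm_le hst
        · filter_upwards with u hu
          exact h u ⟨hu.1.le, hu.2⟩
        · apply Continuous.intervalIntegrable; fun_prop
    _ ≤ _ := by
        rw [integral_mul_const]
        gcongr
        exact exp_int l s t hl

theorem exist_aux [CompleteSpace E] {b : ℝ} (hb : 0 ≤ b) (k1 k2 : ℝ → E → E)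
    (hk1 : Continuous (Function.uncurry k1)) (hk2 : Continuous (Function.uncurry k2))
    (C : ℝ) (hC : 0 ≤ C) (l1 : ∀ t x y, ‖k1 t x - k1 t y‖ ≤ C * ‖x - y‖)
    (l2 : ∀ t x y, ‖k2 t x - k2 t y‖ ≤ C * ‖x - y‖)
    (f : ℝ × ℝ → E) (hf : Continuous f) :
    ∃ H : ℝ × ℝ → E, Continuous H ∧ ∀ ξ η : ℝ, (ξ, η) ∈ Xi b →
      H (ξ, η) = f (ξ, η) - (∫ u in ξ..(b - η), k1 (u + η) (H (u, η)))
        - ∫ v in η..(b - ξ), k2 (ξ + v) (H (ξ, v)) := by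
  have : CompactSpace (Xi b) := isCompact_iff_compactSpace.mp (Xi_compact b)
  have : Nonempty (Xi b) := ⟨⟨_, retr_mem hb 0⟩⟩
  obtain ⟨l, hl⟩ : ∃ l : ℝ, l = 4 * C + 1 := ⟨_, rfl⟩
  have hl0 : 0 < l := by linarith
  -- unweighted function associated with a weighted one
  let ext : C(Xi b, E) → ℝ × ℝ → E := fun G p =>
    Real.exp (l * (b - p.1 - p.2)) • G ⟨retr b p, retr_mem hb p⟩
  have hext : ∀ G, Continuous (ext G) := by
    intro G
    have : Continuous fun p => (⟨retr b p, retr_mem hb p⟩ : Xi b) :=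
      (retr_cont b).subtype_mk _
    have h2 := G.continuous.comp this
    exact (by fun_prop : Continuous fun p : ℝ × ℝ => Real.exp (l * (b - p.1 - p.2))).smul h2
  let raw : C(Xi b, E) → ℝ × ℝ → E := fun G p =>
    f p - (∫ u in p.1..(b - p.2), k1 (u + p.2) (ext G (u, p.2)))
      - ∫ v in p.2..(b - p.1), k2 (p.1 + v) (ext G (p.1, v))
  have hc1 : ∀ G, Continuous (Function.uncurry fun (p : ℝ × ℝ) (u : ℝ) =>
      k1 (u + p.2) (ext G (u, p.2))) := by
    intro G
    have h1 := hext G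
    exact hk1.comp ((by fun_prop : Continuous fun x : (ℝ × ℝ) × ℝ => x.2 + x.1.2).prodMk
      (h1.comp (by fun_prop : Continuous fun x : (ℝ × ℝ) × ℝ => (x.2, x.1.2))))
  have hc2 : ∀ G, Continuous (Function.uncurry fun (p : ℝ × ℝ) (v : ℝ) =>
      k2 (p.1 + v) (ext G (p.1, v))) := by
    intro G
    have h1 := hext G
    exact hk2.comp ((by fun_prop : Continuous fun x : (ℝ × ℝ) × ℝ => x.1.1 + x.2).prodMk
      (h1.comp (by fun_prop : Continuous fun x : (ℝ × ℝ) × ℝ => (x.1.1, x.2))))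
  have hraw : ∀ G, Continuous (raw G) := by
    intro G
    exact (hf.sub (cont_par _ (hc1 G) _ _ (by fun_prop) (by fun_prop))).sub
      (cont_par _ (hc2 G) _ _ (by fun_prop) (by fun_prop))
  let T : C(Xi b, E) → C(Xi b, E) := fun G =>
    ⟨fun p => Real.exp (-(l * (b - p.1.1 - p.1.2))) • raw G p.1,
      (by fun_prop : Continuous fun p : Xi b => Real.exp (-(l * (b - p.1.1 - p.1.2)))).smul
        ((hraw G).comp continuous_subtype_val)⟩
  have hdiff : ∀ G G' : C(Xi b, E), ∀ p : ℝ × ℝ,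
      ‖ext G p - ext G' p‖ ≤ Real.exp (l * (b - p.1 - p.2)) * dist G G' := by
    intro G G' p
    simp only [ext]
    rw [← smul_sub, norm_smul, Real.norm_of_nonneg (Real.exp_pos _).le, ← dist_eq_norm]
    gcongr
    exact ContinuousMap.dist_apply_le_dist _
  have hT : ContractingWith (1 / 2) T := by
    refine ⟨by rw [← NNReal.coe_lt_coe]; norm_num, LipschitzWith.of_dist_le_mul fun G G' => ?_⟩
    rw [ContinuousMap.dist_le (by positivity)]
    rintro ⟨⟨ξ, η⟩, hp⟩
    obtain ⟨h1, h2, h3⟩ := hp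
    simp only at h1 h2 h3
    simp only [T, raw, ContinuousMap.coe_mk]
    set W := Real.exp (l * (b - ξ - η)) with hW
    have hWpos : 0 < W := Real.exp_pos _
    rw [dist_eq_norm, ← smul_sub, norm_smul, Real.norm_of_nonneg (Real.exp_pos _).le,
      Real.exp_neg, ← hW]
    have d1 := diff_int (fun u => k1 (u + η) (ext G (u, η))) (fun u => k1 (u + η) (ext G' (u, η)))
      ((hc1 G).comp (by fun_prop : Continuous fun u : ℝ => (((ξ, η) : ℝ × ℝ), u)))
      ((hc1 G').comp (by fun_prop : Continuous fun u : ℝ => (((ξ, η) : ℝ × ℝ), u)))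
      ξ (b - η) l (C * (W * dist G G')) (by linarith) hl0 (by positivity) (by
        intro u hu
        refine (l1 _ _ _).trans ?_
        have := hdiff G G' (u, η)
        have e : Real.exp (l * (b - u - η)) = Real.exp (-l * (u - ξ)) * W := by
          rw [hW, ← Real.exp_add]; congr 1; ring
        simp only [e] at this
        calc _ ≤ C * (Real.exp (-l * (u - ξ)) * W * dist G G') := by gcongr
          _ = _ := by ring)
    have d2 := diff_int (fun v => k2 (ξ + v) (ext G (ξ, v))) (fun v => k2 (ξ + v) (ext G' (ξ, v)))
      ((hc2 G).comp (by fun_prop : Continuous fun u : ℝ => (((ξ, η) : ℝ × ℝ), u)))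
      ((hc2 G').comp (by fun_prop : Continuous fun u : ℝ => (((ξ, η) : ℝ × ℝ), u)))
      η (b - ξ) l (C * (W * dist G G')) (by linarith) hl0 (by positivity) (by
        intro u hu
        refine (l2 _ _ _).trans ?_
        have := hdiff G G' (ξ, u)
        have e : Real.exp (l * (b - ξ - u)) = Real.exp (-l * (u - η)) * W := by
          rw [hW, ← Real.exp_add]; congr 1; ring
        simp only [e] at this
        calc _ ≤ C * (Real.exp (-l * (u - η)) * W * dist G G') := by gcongr
          _ = _ := by ring)
    have hlC : l⁻¹ * C ≤ 1 / 4 := by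
      rw [inv_mul_le_iff₀ hl0]; linarith
    rw [inv_mul_le_iff₀ hWpos]
    have hd : 0 ≤ W * dist G G' := by positivity
    have := mul_le_mul_of_nonneg_right hlC hd
    calc _ = ‖((∫ v in η..(b - ξ), k2 (ξ + v) (ext G' (ξ, v)))
            - ∫ v in η..(b - ξ), k2 (ξ + v) (ext G (ξ, v)))
          - ((∫ u in ξ..(b - η), k1 (u + η) (ext G (u, η)))
            - ∫ u in ξ..(b - η), k1 (u + η) (ext G' (u, η)))‖ := by congr 1; abel
      _ ≤ _ := (norm_sub_le _ _)
      _ ≤ l⁻¹ * (C * (W * dist G G')) + l⁻¹ * (C * (W * dist G G')) := by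
          rw [norm_sub_rev] at d2; exact add_le_add d2 d1
      _ ≤ _ := by
          have e : ((1 / 2 : NNReal) : ℝ) = 1 / 2 := by norm_num
          rw [e]; linarith
  obtain ⟨G, hG⟩ : ∃ G, T G = G := ⟨_, hT.fixedPoint_isFixedPt⟩
  refine ⟨ext G, hext G, fun ξ η h => ?_⟩
  have h1 : ext G (ξ, η) = Real.exp (l * (b - ξ - η)) • (T G) ⟨(ξ, η), h⟩ := by
    rw [hG]
    simp only [ext, retr_eq h]
  rw [h1]
  simp only [T, raw, ContinuousMap.coe_mk]
  rw [smul_smul, ← Real.exp_add]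
  simp
end Exist

/-- Sup of a function over the level `ξ + η = t`. -/
def levelSup (b : ℝ) (g : ℝ × ℝ → ℝ) (t : ℝ) : ℝ :=
  sSup ((fun θ => g (retr b (θ * t, (1 - θ) * t))) '' Icc (0 : ℝ) 1)

theorem levelSup_cont (b : ℝ) (g : ℝ × ℝ → ℝ) (hg : Continuous g) :
    Continuous (levelSup b g) := by
  have hr := retr_cont b
  exact isCompact_Icc.continuous_sSup
    (f := fun t θ => g (retr b (θ * t, (1 - θ) * t)))
    (hg.comp (hr.comp (by fun_prop : Continuous fun x : ℝ × ℝ => (x.2 * x.1, (1 - x.2) * x.1))))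

theorem le_levelSup (b : ℝ) (g : ℝ × ℝ → ℝ) (hg : Continuous g) {ξ η : ℝ} (h : (ξ, η) ∈ Xi b) :
    g (ξ, η) ≤ levelSup b g (ξ + η) := by
  have hr := retr_cont b
  have hc : Continuous fun θ : ℝ => g (retr b (θ * (ξ + η), (1 - θ) * (ξ + η))) := by fun_prop
  have hbdd := (isCompact_Icc (a := (0:ℝ)) (b := 1)).bddAbove_image hc.continuousOn
  obtain ⟨h1, h2, h3⟩ := id h
  simp only at h1 h2 h3
  apply le_csSup hbdd
  rcases eq_or_lt_of_le (add_nonneg h1 h2) with h0 | h0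
  · have e1 : ξ = 0 := by linarith
    have e2 : η = 0 := by linarith
    subst e1 e2
    refine ⟨0, by simp, ?_⟩
    simp [retr_eq h]
  · refine ⟨ξ / (ξ + η), ⟨by positivity, by rw [div_le_one h0]; linarith⟩, ?_⟩
    have e1 : ξ / (ξ + η) * (ξ + η) = ξ := by field_simp
    have e2 : (1 - ξ / (ξ + η)) * (ξ + η) = η := by field_simp; ring
    simp only [e1, e2, retr_eq h]

theorem levelSup_le {b : ℝ} (g : ℝ × ℝ → ℝ) {t M : ℝ} (ht : t ∈ Icc 0 b)
    (h : ∀ ξ η, (ξ, η) ∈ Xi b → ξ + η = t → g (ξ, η) ≤ M) : levelSup b g t ≤ M := by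
  apply csSup_le ((nonempty_Icc.mpr zero_le_one).image _)
  rintro _ ⟨θ, ⟨h0, h1⟩, rfl⟩
  have hm : (θ * t, (1 - θ) * t) ∈ Xi b :=
    ⟨mul_nonneg h0 ht.1, mul_nonneg (by linarith) ht.1, by
      have := ht.2
      simp only
      linarith⟩
  simp only [retr_eq hm]
  exact h _ _ hm (by ring)

theorem clm_int {E E' : Type*} [NormedAddCommGroup E] [NormedSpace ℝ E] [CompleteSpace E]
    [NormedAddCommGroup E'] [NormedSpace ℝ E'] [CompleteSpace E'] (L : E →L[ℝ] E') (g : ℝ → E)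
    (hg : Continuous g) (a b : ℝ) : L (∫ u in a..b, g u) = ∫ u in a..b, L (g u) :=
  (L.intervalIntegral_comp_comm (hg.intervalIntegrable a b)).symm

theorem int_deriv {E : Type*} [NormedAddCommGroup E] [NormedSpace ℝ E] [CompleteSpace E]
    (g : ℝ → E) (hg : Continuous g) (a t : ℝ) (c : E) :
    HasDerivAt (fun τ => c + ∫ u in a..τ, g u) (g t) t :=
  (integral_hasDerivAt_right (hg.intervalIntegrable _ _)
      (hg.stronglyMeasurableAtFilter _ _) hg.continuousAt).const_add _

theorem bound_aux {b : ℝ} (Q : ℝ → Matrix (Fin 2) (Fin 2) ℂ)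
    (hQ : Continuous Q) (q c : ℝ) (hc : 0 ≤ c) (hq : ∀ t ∈ Icc 0 b, ‖Q t‖ ≤ q)
    (f H : ℝ × ℝ → Matrix (Fin 2) (Fin 2) ℂ) (hH : Continuous H)
    (hf : ∀ p ∈ Xi b, ∀ i j, ‖Phi (f p) i j‖ ≤ c)
    (heq : ∀ ξ η : ℝ, (ξ, η) ∈ Xi b →
      H (ξ, η) = f (ξ, η) - (∫ u in ξ..(b - η), Bmat * Q (u + η) * Pplus (H (u, η)))
        - ∫ v in η..(b - ξ), Bmat * Q (ξ + v) * Pminus (H (ξ, v)))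
    (ξ η : ℝ) (hp : (ξ, η) ∈ Xi b) : ‖H (ξ, η)‖ ≤ 2 * c * Real.exp (b * q) := by
  have hb : 0 ≤ b := by
    obtain ⟨h1, h2, h3⟩ := hp
    simp only at h1 h2 h3
    linarith
  let g : Fin 2 → Fin 2 → ℝ × ℝ → ℝ := fun i j p => ‖Phi (H p) i j‖
  have hg : ∀ i j, Continuous (g i j) := fun i j => ((phiL i j).continuous.comp hH).norm
  let X : ℝ → Matrix (Fin 2) (Fin 2) ℝ := fun t i j => levelSup b (g i j) t
  have hX : ∀ i j, Continuous fun t => X t i j := fun i j => levelSup_cont b _ (hg i j)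
  let K : ℝ → Matrix (Fin 2) (Fin 2) ℝ := fun t i j => ‖Phi (Q t) i j‖
  have hK : ∀ i j, Continuous fun t => K t i j := fun i j =>
    ((phiL i j).continuous.comp hQ).norm
  let A : ℝ → Matrix (Fin 2) (Fin 2) ℝ := fun t => K t * X t
  have hAe : ∀ t i j, A t i j = K t i (j + 1) * X t (j + 1) j + K t i j * X t j j := by
    intro t i j
    simp only [A]
    rw [Matrix.mul_apply, Fin.sum_univ_two]
    fin_cases j
    · exact add_comm _ _
    · rfl
  have hA : Continuous A := by
    apply continuous_matrix
    intro i j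
    simp only [hAe]
    exact ((hK _ _).mul (hX _ _)).add ((hK _ _).mul (hX _ _))
  have hgX : ∀ ξ η i j, (ξ, η) ∈ Xi b → ‖Phi (H (ξ, η)) i j‖ ≤ X (ξ + η) i j :=
    fun ξ η i j h => le_levelSup b (g i j) (hg i j) h
  let V : ℝ → Matrix (Fin 2) (Fin 2) ℝ := fun τ =>
    (Matrix.of fun _ _ => c) + ∫ σ in (0:ℝ)..τ, A (b - σ)
  have hA' : Continuous fun σ => A (b - σ) := by fun_prop
  let ent : Fin 2 → Fin 2 → Matrix (Fin 2) (Fin 2) ℝ →L[ℝ] ℝ := fun i j =>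
    LinearMap.toContinuousLinearMap (Matrix.entryLinearMap ℝ ℝ i j)
  have hVe : ∀ t i j, V (b - t) i j = c + ∫ s in t..b, A s i j := by
    intro t i j
    have h1 : (∫ σ in (0:ℝ)..(b - t), A (b - σ)) i j = ∫ s in t..b, A s i j := by
      have h2 := clm_int (ent i j) _ hA' 0 (b - t)
      have h3 : (∫ σ in (0:ℝ)..(b - t), A (b - σ)) i j =
          ∫ σ in (0:ℝ)..(b - t), A (b - σ) i j := h2
      rw [h3, integral_comp_sub_left (fun s => A s i j) b]
      simp
    simp only [V]
    rw [Matrix.add_apply, h1]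
    rfl
  -- the key pointwise estimate
  have key : ∀ ξ η i j, (ξ, η) ∈ Xi b → ‖Phi (H (ξ, η)) i j‖ ≤ V (b - (ξ + η)) i j := by
    intro ξ η i j h
    obtain ⟨h1, h2, h3⟩ := id h
    simp only at h1 h2 h3
    have c1 : Continuous fun u => Bmat * Q (u + η) * Pplus (H (u, η)) := by
      unfold Pplus
      fun_prop
    have c2 : Continuous fun v => Bmat * Q (ξ + v) * Pminus (H (ξ, v)) := by
      unfold Pminus
      fun_prop
    have e := congrArg (phiL i j) (heq ξ η h)
    have m1 : phiL i j (∫ u in ξ..(b - η), Bmat * Q (u + η) * Pplus (H (u, η))) =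
        ∫ u in ξ..(b - η), phiL i j (Bmat * Q (u + η) * Pplus (H (u, η))) :=
      clm_int (phiL i j) _ c1 _ _
    have m2 : phiL i j (∫ v in η..(b - ξ), Bmat * Q (ξ + v) * Pminus (H (ξ, v))) =
        ∫ v in η..(b - ξ), phiL i j (Bmat * Q (ξ + v) * Pminus (H (ξ, v))) :=
      clm_int (phiL i j) _ c2 _ _
    rw [map_sub, map_sub, m1, m2] at e
    simp only [phiL_apply] at e
    rw [e, hVe]
    have i1 : ‖∫ u in ξ..(b - η), Phi (Bmat * Q (u + η) * Pplus (H (u, η))) i j‖ ≤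
        ∫ s in (ξ + η)..b, K s i (j + 1) * X s (j + 1) j := by
      have : ∫ s in (ξ + η)..b, K s i (j + 1) * X s (j + 1) j =
          ∫ u in ξ..(b - η), K (u + η) i (j + 1) * X (u + η) (j + 1) j := by
        rw [integral_comp_add_right (fun s => K s i (j + 1) * X s (j + 1) j) η]
        simp
      rw [this]
      apply norm_integral_le_of_norm_le (by linarith)
      · filter_upwards with u hu
        rw [Phi_plus]
        exact mul_le_mul_of_nonneg_left
          (hgX u η _ _ ⟨by simp; linarith [hu.1], h2, by simp; linarith [hu.2]⟩) (norm_nonneg _)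
      · exact (((hK _ _).mul (hX _ _)).comp
          (by fun_prop : Continuous fun u : ℝ => u + η)).intervalIntegrable _ _
    have i2 : ‖∫ v in η..(b - ξ), Phi (Bmat * Q (ξ + v) * Pminus (H (ξ, v))) i j‖ ≤
        ∫ s in (ξ + η)..b, K s i j * X s j j := by
      have : ∫ s in (ξ + η)..b, K s i j * X s j j =
          ∫ v in η..(b - ξ), K (ξ + v) i j * X (ξ + v) j j := by
        rw [integral_comp_add_left (fun s => K s i j * X s j j) ξ]
        simp
      rw [this]
      apply norm_integral_le_of_norm_le (by linarith)
      · filter_upwards with v hv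
        rw [Phi_minus]
        exact mul_le_mul_of_nonneg_left
          (hgX ξ v _ _ ⟨h1, by simp; linarith [hv.1], by simp; linarith [hv.2]⟩) (norm_nonneg _)
      · exact (((hK _ _).mul (hX _ _)).comp
          (by fun_prop : Continuous fun v : ℝ => ξ + v)).intervalIntegrable _ _
    have i3 : ∫ s in (ξ + η)..b, A s i j = (∫ s in (ξ + η)..b, K s i (j + 1) * X s (j + 1) j)
        + ∫ s in (ξ + η)..b, K s i j * X s j j := by
      simp only [hAe]
      exact integral_add (((hK _ _).mul (hX _ _)).intervalIntegrable _ _)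
        (((hK _ _).mul (hX _ _)).intervalIntegrable _ _)
    rw [i3]
    refine (norm_sub_le _ _).trans ?_
    have := norm_sub_le (Phi (f (ξ, η)) i j)
      (∫ u in ξ..(b - η), Phi (Bmat * Q (u + η) * Pplus (H (u, η))) i j)
    have := hf _ h i j
    linarith
  have hX0 : ∀ t ∈ Icc 0 b, ∀ i j, 0 ≤ X t i j := by
    intro t ht i j
    have hm : ((0:ℝ), t) ∈ Xi b := ⟨le_rfl, ht.1, by simpa using ht.2⟩
    have := hgX 0 t i j hm
    rw [zero_add] at this
    exact (norm_nonneg _).trans this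
  have hXV : ∀ t ∈ Icc 0 b, ‖X t‖ ≤ ‖V (b - t)‖ := by
    intro t ht
    apply frob_le
    intro i j
    have h1 : X t i j ≤ V (b - t) i j := by
      apply levelSup_le _ ht
      intro ξ η h he
      rw [← he]
      exact key ξ η i j h
    rw [Real.norm_of_nonneg (hX0 t ht i j)]
    exact h1.trans (le_abs_self _)
  have hder : ∀ τ, HasDerivAt V (A (b - τ)) τ := by
    intro τ
    exact int_deriv _ hA' 0 τ _
  have hAV : ∀ τ ∈ Ico 0 b, ‖A (b - τ)‖ ≤ q * ‖V τ‖ + 0 := by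
    intro τ hτ
    have hm : b - τ ∈ Icc 0 b := ⟨by linarith [hτ.2], by linarith [hτ.1]⟩
    have h1 : ‖K (b - τ)‖ ≤ q := by
      have : ‖K (b - τ)‖ ≤ ‖Phi (Q (b - τ))‖ := by
        apply frob_le
        intro i j
        simp [K]
      exact this.trans ((norm_Phi _).le.trans (hq _ hm))
    have h2 := hXV _ hm
    rw [sub_sub_cancel] at h2
    rw [add_zero]
    exact (Matrix.frobenius_norm_mul _ _).trans
      (mul_le_mul h1 h2 (norm_nonneg _) ((norm_nonneg _).trans h1))
  have hV0 : ‖V 0‖ ≤ 2 * c := by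
    apply le_of_sq_le_sq _ (by positivity)
    rw [frob_sq]
    simp [V]
    apply le_of_eq
    ring
  have gron := norm_le_gronwallBound_of_norm_deriv_right_le (f := V) (f' := fun τ => A (b - τ))
    (δ := 2 * c) (K := q) (ε := 0) (a := 0) (b := b)
    (fun τ _ => (hder τ).continuousAt.continuousWithinAt)
    (fun τ _ => (hder τ).hasDerivWithinAt) hV0 hAV
  obtain ⟨h1, h2, h3⟩ := id hp
  simp only at h1 h2 h3
  have hq0 : 0 ≤ q := (norm_nonneg _).trans (hq 0 ⟨le_rfl, hb⟩)
  have g1 := gron (b - (ξ + η)) ⟨by linarith, by linarith⟩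
  rw [gronwallBound_ε0, sub_zero] at g1
  have f1 : ‖H (ξ, η)‖ ≤ ‖V (b - (ξ + η))‖ := by
    rw [← norm_Phi]
    apply frob_le
    intro i j
    exact (key ξ η i j hp).trans (le_abs_self _)
  refine f1.trans (g1.trans ?_)
  have : q * (b - (ξ + η)) ≤ b * q := by nlinarith
  gcongr

theorem int_congr_sub {E : Type*} [NormedAddCommGroup E] [NormedSpace ℝ E]
    (g g' : ℝ → E) (hg : Continuous g) (hg' : Continuous g') (a b : ℝ) :
    (∫ u in a..b, g u) - ∫ u in a..b, g' u = ∫ u in a..b, (g u - g' u) :=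
  (integral_sub (hg.intervalIntegrable a b) (hg'.intervalIntegrable a b)).symm

theorem P_sub (Q A A' : Matrix (Fin 2) (Fin 2) ℂ) :
    Bmat * Q * Pplus A - Bmat * Q * Pplus A' = Bmat * Q * Pplus (A - A') ∧
    Bmat * Q * Pminus A - Bmat * Q * Pminus A' = Bmat * Q * Pminus (A - A') := by
  constructor
  · rw [← mul_sub]; congr 1; unfold Pplus; rw [← smul_sub]; congr 1; noncomm_ring
  · rw [← mul_sub]; congr 1; unfold Pminus; rw [← smul_sub]; congr 1; noncomm_ring

theorem congr_int (b : ℝ) (Q Q' : ℝ → Matrix (Fin 2) (Fin 2) ℂ) (hQ : ∀ t ∈ Icc 0 b, Q t = Q' t)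
    (H H' : ℝ × ℝ → Matrix (Fin 2) (Fin 2) ℂ) (hH : ∀ p ∈ Xi b, H p = H' p)
    {ξ η : ℝ} (h : (ξ, η) ∈ Xi b) :
    (∫ u in ξ..(b - η), Bmat * Q (u + η) * Pplus (H (u, η))) =
      (∫ u in ξ..(b - η), Bmat * Q' (u + η) * Pplus (H' (u, η))) ∧
    (∫ v in η..(b - ξ), Bmat * Q (ξ + v) * Pminus (H (ξ, v))) =
      ∫ v in η..(b - ξ), Bmat * Q' (ξ + v) * Pminus (H' (ξ, v)) := by
  obtain ⟨h1, h2, h3⟩ := h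
  simp only at h1 h2 h3
  constructor
  · apply integral_congr
    intro u hu
    rw [uIcc_of_le (by linarith)] at hu
    simp only
    rw [hQ _ ⟨by linarith [hu.1], by linarith [hu.2]⟩,
      hH (u, η) ⟨by simp; linarith [hu.1], h2, by simp; linarith [hu.2]⟩]
  · apply integral_congr
    intro u hu
    rw [uIcc_of_le (by linarith)] at hu
    simp only
    rw [hQ _ ⟨by linarith [hu.1], by linarith [hu.2]⟩,
      hH (ξ, u) ⟨h1, by simp; linarith [hu.1], by simp; linarith [hu.2]⟩]

theorem stmt_13 (b : ℝ) (hb : 0 ≤ b) (Q F : ℝ → Matrix (Fin 2) (Fin 2) ℂ)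
    (hQ : ContinuousOn Q (Icc 0 b)) (hF : ContinuousOn F (Icc (-b) b)) :
    ∃ H : ℝ → ℝ → Matrix (Fin 2) (Fin 2) ℂ,
      ContinuousOn (fun p : ℝ × ℝ => H p.1 p.2) (Xi b) ∧
      (∀ ξ η : ℝ, (ξ, η) ∈ Xi b →
        H ξ η = Pplus (F (2 * ξ - b)) + Pminus (F (b - 2 * η))
          - (∫ u in ξ..(b - η), Bmat * Q (u + η) * Pplus (H u η))
          - (∫ v in η..(b - ξ), Bmat * Q (ξ + v) * Pminus (H ξ v))) ∧
      (∀ ξ η : ℝ, (ξ, η) ∈ Xi b →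
        ‖H ξ η‖ ≤ 2 * (⨆ t : Icc (-b) b, ‖F t‖) * Real.exp (b * ⨆ x : Icc 0 b, ‖Q x‖)) ∧
      (∀ H' : ℝ → ℝ → Matrix (Fin 2) (Fin 2) ℂ,
        ContinuousOn (fun p : ℝ × ℝ => H' p.1 p.2) (Xi b) →
        (∀ ξ η : ℝ, (ξ, η) ∈ Xi b →
          H' ξ η = Pplus (F (2 * ξ - b)) + Pminus (F (b - 2 * η))
            - (∫ u in ξ..(b - η), Bmat * Q (u + η) * Pplus (H' u η))
            - (∫ v in η..(b - ξ), Bmat * Q (ξ + v) * Pminus (H' ξ v))) →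
        ∀ ξ η : ℝ, (ξ, η) ∈ Xi b → H' ξ η = H ξ η) := by
  have hbb : -b ≤ b := by linarith
  let Qe : ℝ → Matrix (Fin 2) (Fin 2) ℂ := IccExtend hb (fun x : Icc 0 b => Q x)
  let Fe : ℝ → Matrix (Fin 2) (Fin 2) ℂ := IccExtend hbb (fun x : Icc (-b) b => F x)
  have hQe : Continuous Qe := (continuousOn_iff_continuous_domRestrict.mp hQ).Icc_extend'
  have hFe : Continuous Fe := (continuousOn_iff_continuous_domRestrict.mp hF).Icc_extend'
  have hQQ : ∀ t ∈ Icc 0 b, Q t = Qe t := fun t ht => by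
    simp only [Qe]; rw [IccExtend_of_mem hb _ ht]
  have hFF : ∀ t ∈ Icc (-b) b, F t = Fe t := fun t ht => by
    simp only [Fe]; rw [IccExtend_of_mem hbb _ ht]
  have hnQ : ContinuousOn (fun t => ‖Q t‖) (Icc 0 b) := continuous_norm.comp_continuousOn hQ
  have hnF : ContinuousOn (fun t => ‖F t‖) (Icc (-b) b) := continuous_norm.comp_continuousOn hF
  have bQ := isCompact_Icc.bddAbove_image hnQ
  have bF := isCompact_Icc.bddAbove_image hnF
  rw [image_eq_range] at bQ bF
  set q := ⨆ x : Icc 0 b, ‖Q x‖ with hqdef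
  set c := ⨆ t : Icc (-b) b, ‖F t‖ with hcdef
  have leq : ∀ t ∈ Icc 0 b, ‖Q t‖ ≤ q := fun t ht => le_ciSup bQ ⟨t, ht⟩
  have lec : ∀ t ∈ Icc (-b) b, ‖F t‖ ≤ c := fun t ht => le_ciSup bF ⟨t, ht⟩
  have leqe : ∀ t, ‖Qe t‖ ≤ q := fun t => leq _ (projIcc 0 b hb t).2
  have leqe' : ∀ t ∈ Icc 0 b, ‖Qe t‖ ≤ q := fun t _ => leqe t
  have lece : ∀ t, ‖Fe t‖ ≤ c := fun t => lec _ (projIcc (-b) b hbb t).2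
  have hc0 : 0 ≤ c := (norm_nonneg _).trans (lece 0)
  have hq0 : 0 ≤ q := (norm_nonneg _).trans (leqe 0)
  let f : ℝ × ℝ → Matrix (Fin 2) (Fin 2) ℂ := fun p =>
    Pplus (Fe (2 * p.1 - b)) + Pminus (Fe (b - 2 * p.2))
  have hf : Continuous f := by
    simp only [f]
    unfold Pplus Pminus
    fun_prop
  have hff : ∀ ξ η : ℝ, (ξ, η) ∈ Xi b →
      Pplus (F (2 * ξ - b)) + Pminus (F (b - 2 * η)) = f (ξ, η) := by
    rintro ξ η ⟨h1, h2, h3⟩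
    simp only at h1 h2 h3
    rw [hFF _ ⟨by linarith, by linarith⟩, hFF (b - 2 * η) ⟨by linarith, by linarith⟩]
  obtain ⟨C, hC, hCb⟩ := P_bounds
  obtain ⟨H, hH, hHe⟩ := exist_aux hb (fun t A => Bmat * Qe t * Pplus A)
    (fun t A => Bmat * Qe t * Pminus A)
    (by unfold Pplus Function.uncurry; fun_prop) (by unfold Pminus Function.uncurry; fun_prop)
    (C * q) (by positivity)
    (fun t x y => ((hCb (Qe t) x y).1).trans (by gcongr; exact leqe t))
    (fun t x y => ((hCb (Qe t) x y).2).trans (by gcongr; exact leqe t)) f hf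
  refine ⟨fun ξ η => H (ξ, η), hH.continuousOn, ?_, ?_, ?_⟩
  · intro ξ η h
    have e := congr_int b Q Qe hQQ H H (fun _ _ => rfl) h
    rw [hff ξ η h, e.1, e.2]
    exact hHe ξ η h
  · exact bound_aux Qe hQe q c hc0 leqe' f H hH
      (fun p _ i j => phi_data _ _ c (lece _) (lece _) i j) hHe
  · intro H' hH'c hH' ξ η h
    let G : ℝ × ℝ → Matrix (Fin 2) (Fin 2) ℂ := fun p => H' (retr b p).1 (retr b p).2
    have hG : Continuous G :=
      hH'c.comp_continuous (retr_cont b) (retr_mem hb)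
    have hGe : ∀ p ∈ Xi b, (fun p : ℝ × ℝ => H' p.1 p.2) p = G p := by
      intro p hp
      simp only [G, retr_eq hp]
    let D : ℝ × ℝ → Matrix (Fin 2) (Fin 2) ℂ := fun p => G p - H p
    have hD : Continuous D := hG.sub hH
    have hDe : ∀ ξ η : ℝ, (ξ, η) ∈ Xi b →
        D (ξ, η) = (fun _ => 0 : ℝ × ℝ → Matrix (Fin 2) (Fin 2) ℂ) (ξ, η)
          - (∫ u in ξ..(b - η), Bmat * Qe (u + η) * Pplus (D (u, η)))
          - ∫ v in η..(b - ξ), Bmat * Qe (ξ + v) * Pminus (D (ξ, v)) := by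
      intro ξ η h
      have e := congr_int b Q Qe hQQ (fun p : ℝ × ℝ => H' p.1 p.2) G hGe h
      have e1 := hH' ξ η h
      rw [hff ξ η h, e.1, e.2] at e1
      have e0 : G (ξ, η) = H' ξ η := (hGe _ h).symm
      have e2 := hHe ξ η h
      have c1 : ∀ H : ℝ × ℝ → Matrix (Fin 2) (Fin 2) ℂ, Continuous H →
          Continuous fun u => Bmat * Qe (u + η) * Pplus (H (u, η)) := by
        intro H hH
        unfold Pplus
        fun_prop
      have c2 : ∀ H : ℝ × ℝ → Matrix (Fin 2) (Fin 2) ℂ, Continuous H →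
          Continuous fun v => Bmat * Qe (ξ + v) * Pminus (H (ξ, v)) := by
        intro H hH
        unfold Pminus
        fun_prop
      have s1 := int_congr_sub _ _ (c1 G hG) (c1 H hH) ξ (b - η)
      have s2 := int_congr_sub _ _ (c2 G hG) (c2 H hH) η (b - ξ)
      simp only [(P_sub _ _ _).1] at s1
      simp only [(P_sub _ _ _).2] at s2
      simp only [D]
      rw [← s1, ← s2, e0, e1, e2]
      abel
    have hz := bound_aux Qe hQe q 0 le_rfl leqe' (fun _ => 0) D hD
      (fun p _ i j => by rw [← phiL_apply, map_zero, norm_zero]) hDe ξ η h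
    have hz' : D (ξ, η) = 0 := by
      apply norm_le_zero_iff.mp
      simpa using hz
    have e0 : H' ξ η = G (ξ, η) := hGe _ h
    change H' ξ η = H (ξ, η)
    rw [e0]
    exact sub_eq_zero.mp hz'
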